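/- arXiv:2312.01243 — 2 statements merged into one kernel-verified Lean document; each statement's English description precedes it below -/
import Mathlib

section
/- Let S be an inverse semigroup. The relation μ on S, defined by a μ b iff a⁻¹·e·a = b⁻¹·e·b for every idempotent e of S, is a congruence on S, it is idempotent-separating, and every idempotent-separating congruence on S is contained in μ. Hence μ is the maximum idempotent-separating congruence on S. -/
/-- An inverse semigroup: every element has a unique inverse. -/
class InverseSemigroup (S : Type*) extends Semigroup S, Inv S where
  mul_inv_mul : ∀ a : S, a * a⁻¹ * a = a
  inv_mul_inv : ∀ a : S, a⁻¹ * a * a⁻¹ = a⁻¹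
  inv_unique : ∀ a b : S, a * b * a = a → b * a * b = b → b = a⁻¹

/-- `a` is an idempotent. -/
def IsIdem {S : Type*} [Mul S] (a : S) : Prop := a * a = a

/-- The natural partial order on an inverse semigroup: `a ≤ b` iff `a = b * e`
for some idempotent `e`. -/
def natLe {S : Type*} [InverseSemigroup S] (a b : S) : Prop :=
  ∃ e : S, IsIdem e ∧ a = b * e

/-- `a` and `b` are compatible: both `a⁻¹ * b` and `a * b⁻¹` are idempotents. -/
def Compatible {S : Type*} [InverseSemigroup S] (a b : S) : Prop :=
  IsIdem (a⁻¹ * b) ∧ IsIdem (a * b⁻¹)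

/-- `c` is the least upper bound of `{a, b}` with respect to the natural partial order. -/
def IsLubPair {S : Type*} [InverseSemigroup S] (a b c : S) : Prop :=
  natLe a c ∧ natLe b c ∧ ∀ d : S, natLe a d → natLe b d → natLe c d

/-- The relation `μ`: `a μ b` iff `a⁻¹ * e * a = b⁻¹ * e * b` for every idempotent `e`. -/
def mu {S : Type*} [InverseSemigroup S] (a b : S) : Prop :=
  ∀ e : S, IsIdem e → a⁻¹ * e * a = b⁻¹ * e * b

/-- A congruence: an equivalence relation compatible with multiplication on both sides. -/
def IsCongruence {S : Type*} [InverseSemigroup S] (ρ : S → S → Prop) : Prop :=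
  Equivalence ρ ∧ ∀ a b c : S, ρ a b → ρ (c * a) (c * b) ∧ ρ (a * c) (b * c)

/-- A relation is idempotent-separating if any two related idempotents are equal. -/
def IdempotentSeparating {S : Type*} [InverseSemigroup S] (ρ : S → S → Prop) : Prop :=
  ∀ e f : S, IsIdem e → IsIdem f → ρ e f → e = f

namespace InverseSemigroup

variable {S : Type*} [InverseSemigroup S]

theorem isIdem_inv_mul (a : S) : IsIdem (a⁻¹ * a) := by
  unfold IsIdem
  rw [← mul_assoc, inv_mul_inv]

theorem isIdem_mul_inv (a : S) : IsIdem (a * a⁻¹) := by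
  unfold IsIdem
  rw [← mul_assoc, mul_inv_mul]

theorem inv_eq_self_of_isIdem {e : S} (he : IsIdem e) : e⁻¹ = e := by
  unfold IsIdem at he
  exact (inv_unique e e (by rw [he, he]) (by rw [he, he])).symm

theorem isIdem_mul {e f : S} (he : IsIdem e) (hf : IsIdem f) : IsIdem (e * f) := by
  have h1 := mul_inv_mul (e * f)
  have h2 := inv_mul_inv (e * f)
  have hx : f * (e * f)⁻¹ * e = (e * f)⁻¹ := by
    apply inv_unique <;> unfold IsIdem at he hf <;> grind
  have hxx : IsIdem (e * f)⁻¹ := by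
    unfold IsIdem at *
    grind
  have : e * f = ((e * f)⁻¹)⁻¹ := inv_unique _ _ h2 h1
  rw [this, inv_eq_self_of_isIdem hxx]
  exact hxx

theorem mul_comm_of_isIdem {e f : S} (he : IsIdem e) (hf : IsIdem f) : e * f = f * e := by
  have hef := isIdem_mul he hf
  have hfe := isIdem_mul hf he
  rw [← inv_eq_self_of_isIdem hef]
  symm
  apply inv_unique <;> unfold IsIdem at * <;> grind

theorem mul_inv_rev (a b : S) : (a * b)⁻¹ = b⁻¹ * a⁻¹ := by
  have h := mul_comm_of_isIdem (isIdem_mul_inv b) (isIdem_inv_mul a)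
  have := mul_inv_mul a
  have := mul_inv_mul b
  have := inv_mul_inv a
  have := inv_mul_inv b
  symm
  apply inv_unique <;> grind

theorem isIdem_conj (a : S) {e : S} (he : IsIdem e) : IsIdem (a⁻¹ * e * a) := by
  have h := mul_comm_of_isIdem (isIdem_mul_inv a) he
  have := mul_inv_mul a
  unfold IsIdem at *
  grind

theorem isCongruence_mu : IsCongruence (mu (S := S)) := by
  refine ⟨⟨fun _ _ _ => rfl, fun h e he => (h e he).symm,
    fun h k e he => (h e he).trans (k e he)⟩, fun a b c h => ⟨fun e he => ?_, fun e he => ?_⟩⟩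
  · have := h _ (isIdem_conj c he)
    simpa only [mul_inv_rev, mul_assoc] using this
  · have := congrArg (fun x => c⁻¹ * x * c) (h e he)
    simpa only [mul_inv_rev, mul_assoc] using this

theorem idempotentSeparating_mu : IdempotentSeparating (mu (S := S)) := by
  intro e f he hf h
  have h1 := h e he
  have h2 := h f hf
  rw [inv_eq_self_of_isIdem he, inv_eq_self_of_isIdem hf] at h1 h2
  have hc := mul_comm_of_isIdem he hf
  unfold IsIdem at he hf
  grind

theorem inv_mul_congr {ρ : S → S → Prop} (hρ : IsCongruence ρ) {a b : S} (h : ρ a b) :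
    ρ (a⁻¹ * a) (b⁻¹ * b) := by
  obtain ⟨heq, hm⟩ := hρ
  have h1 : ρ (a⁻¹ * a) (a⁻¹ * b) := (hm a b a⁻¹ h).1
  have h2 : ρ (a⁻¹ * a * (b⁻¹ * b)) (a⁻¹ * b) := by
    have := (hm _ _ (b⁻¹ * b) h1).2
    rwa [mul_assoc a⁻¹ b, ← mul_assoc b, mul_inv_mul] at this
  have h3 : ρ (b⁻¹ * a) (b⁻¹ * b) := (hm a b b⁻¹ h).1
  have h4 : ρ (b⁻¹ * a) (b⁻¹ * b * (a⁻¹ * a)) := by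
    have := (hm _ _ (a⁻¹ * a) h3).2
    rwa [mul_assoc b⁻¹ a, ← mul_assoc a, mul_inv_mul] at this
  rw [mul_comm_of_isIdem (isIdem_inv_mul b) (isIdem_inv_mul a)] at h4
  exact heq.trans h1 (heq.trans (heq.symm h2) (heq.trans (heq.symm h4) h3))

theorem mul_inv_congr {ρ : S → S → Prop} (hρ : IsCongruence ρ) {a b : S} (h : ρ a b) :
    ρ (a * a⁻¹) (b * b⁻¹) := by
  obtain ⟨heq, hm⟩ := hρ
  have h1 : ρ (a * a⁻¹) (b * a⁻¹) := (hm a b a⁻¹ h).2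
  have h2 : ρ (b * b⁻¹ * (a * a⁻¹)) (b * a⁻¹) := by
    have := (hm _ _ (b * b⁻¹) h1).1
    rwa [← mul_assoc _ b, mul_inv_mul] at this
  have h3 : ρ (a * b⁻¹) (b * b⁻¹) := (hm a b b⁻¹ h).2
  have h4 : ρ (a * b⁻¹) (a * a⁻¹ * (b * b⁻¹)) := by
    have := (hm _ _ (a * a⁻¹) h3).1
    rwa [← mul_assoc _ a, mul_inv_mul] at this
  rw [mul_comm_of_isIdem (isIdem_mul_inv a) (isIdem_mul_inv b)] at h4
  exact heq.trans h1 (heq.trans (heq.symm h2) (heq.trans (heq.symm h4) h3))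

theorem inv_congr {ρ : S → S → Prop} (hρ : IsCongruence ρ) {a b : S} (h : ρ a b) :
    ρ a⁻¹ b⁻¹ := by
  have hl := inv_mul_congr hρ h
  have hr := mul_inv_congr hρ h
  obtain ⟨heq, hm⟩ := hρ
  have h1 : ρ a⁻¹ (a⁻¹ * (b * b⁻¹)) := by
    simpa only [← mul_assoc, inv_mul_inv] using (hm _ _ a⁻¹ hr).1
  have h2 : ρ (a⁻¹ * a * b⁻¹) (a⁻¹ * b * b⁻¹) := (hm _ _ b⁻¹ (hm _ _ a⁻¹ h).1).2
  have h3 : ρ (a⁻¹ * a * b⁻¹) b⁻¹ := by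
    simpa only [inv_mul_inv] using (hm _ _ b⁻¹ hl).2
  rw [← mul_assoc] at h1
  exact heq.trans h1 (heq.trans (heq.symm h2) h3)

theorem mu_of_idempotentSeparating {ρ : S → S → Prop} (hρ : IsCongruence ρ)
    (hs : IdempotentSeparating ρ) {a b : S} (h : ρ a b) : mu a b := by
  intro e he
  refine hs _ _ (isIdem_conj a he) (isIdem_conj b he) ?_
  have hinv := inv_congr hρ h
  exact hρ.1.trans (hρ.2 _ _ _ h).1 (hρ.2 _ _ b (hρ.2 _ _ e hinv).2).2

end InverseSemigroup

/-- `μ` is the maximum idempotent-separating congruence. -/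
theorem statement5 {S : Type*} [InverseSemigroup S] :
    IsCongruence (mu (S := S)) ∧ IdempotentSeparating (mu (S := S)) ∧
    ∀ ρ : S → S → Prop, IsCongruence ρ → IdempotentSeparating ρ →
      ∀ a b : S, ρ a b → mu a b :=
  ⟨InverseSemigroup.isCongruence_mu, InverseSemigroup.idempotentSeparating_mu,
    fun _ hρ hs _ _ h => InverseSemigroup.mu_of_idempotentSeparating hρ hs h⟩
end

section
/- Let S be an inverse semigroup with zero and let s, t ∈ S be atoms. Then the product s·t is either 0 or an atom of S. -/
/-- An inverse semigroup with a zero element. -/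
class InverseSemigroupWithZero (S : Type*) extends InverseSemigroup S, Zero S where
  zero_mul : ∀ a : S, 0 * a = 0
  mul_zero : ∀ a : S, a * 0 = 0

/-- `a` and `b` are orthogonal: `a⁻¹ * b = 0` and `a * b⁻¹ = 0`. -/
def Orthogonal {S : Type*} [InverseSemigroupWithZero S] (a b : S) : Prop :=
  a⁻¹ * b = 0 ∧ a * b⁻¹ = 0

/-- An atom: a nonzero element with no elements strictly between it and `0`. -/
def IsAtomEl {S : Type*} [InverseSemigroupWithZero S] (s : S) : Prop :=
  s ≠ 0 ∧ ∀ u : S, natLe u s → u = 0 ∨ u = s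

/-- The product of two atoms of an inverse semigroup with zero is zero or an atom. -/
theorem statement15 {S : Type*} [InverseSemigroupWithZero S] (s t : S)
    (hs : IsAtomEl s) (ht : IsAtomEl t) : s * t = 0 ∨ IsAtomEl (s * t) := by
  refine or_iff_not_imp_left.mpr fun h => ⟨h, ?_⟩
  rintro u ⟨e, he, rfl⟩
  rw [mul_assoc]
  rcases ht.2 (t * e) ⟨e, he, rfl⟩ with h0 | h1
  · exact Or.inl (by rw [h0, InverseSemigroupWithZero.mul_zero])
  · exact Or.inr (by rw [h1])
end
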